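/- arXiv:2108.13758 — 2 statements merged into one kernel-verified Lean document; each statement's English description precedes it below -/
import Mathlib

section
/- Let 0 < κ < μ < 1, ω > 0, z_a ∈ ℝ, and let H : [a,b] → ℝ be continuous. If z : [a,b] → ℝ is continuously differentiable with z(a) = z_a and satisfies ᶜD^{μ;Φ}z(ℓ) + ω ᶜD^{κ;Φ}z(ℓ) = H(ℓ) for all ℓ ∈ [a,b], then z has the explicit representation z(ℓ) = z_a + ∫_a^ℓ Φ'(ρ)(Φ(ℓ)−Φ(ρ))^{μ−1} E_{μ−κ,μ}(−ω(Φ(ℓ)−Φ(ρ))^{μ−κ}) H(ρ) dρ for all ℓ ∈ [a,b]. In particular, the linear initial value problem has at most one continuously differentiable solution. -/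
open Real MeasureTheory Set

/-- Two-parameter Mittag-Leffler function `E_{p,q}(x) = ∑_{k=0}^∞ x^k / Γ(pk+q)`. -/
noncomputable def mittagLeffler (p q x : ℝ) : ℝ :=
  ∑' k : ℕ, x ^ k / Real.Gamma (p * k + q)

theorem integral_rpow_mul_sub_rpow {p q T : ℝ} (hp : 0 < p) (hq : 0 < q) (hT : 0 < T) :
    ∫ s in 0..T, s ^ (q - 1) * (T - s) ^ (p - 1) =
      Gamma p * Gamma q / Gamma (p + q) * T ^ (p + q - 1) := by
  have h := Complex.betaIntegral_scaled (q : ℂ) (p : ℂ) hT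
  have h2 : ∫ s in 0..T, (s : ℂ) ^ ((q : ℂ) - 1) * ((T : ℂ) - s) ^ ((p : ℂ) - 1) =
      ∫ s in 0..T, ((s ^ (q - 1) * (T - s) ^ (p - 1) : ℝ) : ℂ) := by
    refine intervalIntegral.integral_congr fun s hs => ?_
    rw [uIcc_of_le hT.le] at hs
    rw [Complex.ofReal_mul, Complex.ofReal_cpow hs.1, Complex.ofReal_cpow (sub_nonneg.2 hs.2)]
    push_cast
    rfl
  rw [h2, intervalIntegral.integral_ofReal] at h
  have h3 : (T : ℂ) ^ ((q : ℂ) + p - 1) = ((T ^ (p + q - 1) : ℝ) : ℂ) := by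
    rw [Complex.ofReal_cpow hT.le]; push_cast; ring_nf
  rw [h3] at h
  have h4 := congrArg Complex.re h
  rw [Complex.ofReal_re, Complex.re_ofReal_mul,
    ← ProbabilityTheory.beta_eq_betaIntegralReal q p hq hp] at h4
  rw [h4, ProbabilityTheory.beta, add_comm q p]
  ring

section weighted

variable {Φ Φ' : ℝ → ℝ} {a ℓ : ℝ}

theorem strictMonoOn_of_hasDerivAt_pos (hd : ∀ x ∈ Icc a ℓ, HasDerivAt Φ (Φ' x) x)
    (hpos : ∀ x ∈ Icc a ℓ, 0 < Φ' x) : StrictMonoOn Φ (Icc a ℓ) := by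
  refine strictMonoOn_of_deriv_pos (convex_Icc a ℓ)
    (fun x hx => (hd x hx).continuousAt.continuousWithinAt) fun x hx => ?_
  rw [interior_Icc] at hx
  rw [(hd x (Ioo_subset_Icc_self hx)).deriv]
  exact hpos x (Ioo_subset_Icc_self hx)

theorem setIntegral_weighted_beta (haℓ : a < ℓ) (hd : ∀ x ∈ Icc a ℓ, HasDerivAt Φ (Φ' x) x)
    (hpos : ∀ x ∈ Icc a ℓ, 0 < Φ' x) {p q : ℝ} (hp : 0 < p) (hq : 0 < q) :
    ∫ ρ in Ioo a ℓ, Φ' ρ * (Φ ℓ - Φ ρ) ^ (p - 1) * (Φ ρ - Φ a) ^ (q - 1) =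
      Gamma p * Gamma q / Gamma (p + q) * (Φ ℓ - Φ a) ^ (p + q - 1) := by
  have hmono := strictMonoOn_of_hasDerivAt_pos hd hpos
  have ha : a ∈ Icc a ℓ := left_mem_Icc.2 haℓ.le
  have hℓ : ℓ ∈ Icc a ℓ := right_mem_Icc.2 haℓ.le
  have himg : Φ '' Ioo a ℓ = Ioo (Φ a) (Φ ℓ) := by
    refine Subset.antisymm ?_ (intermediate_value_Ioo haℓ.le
      fun x hx => (hd x hx).continuousAt.continuousWithinAt)
    rintro _ ⟨x, hx, rfl⟩
    have hx' := Ioo_subset_Icc_self hx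
    exact ⟨hmono ha hx' hx.1, hmono hx' hℓ hx.2⟩
  have hcov := integral_image_eq_integral_abs_deriv_smul (f := Φ) (f' := Φ') (s := Ioo a ℓ)
    measurableSet_Ioo (fun x hx => (hd x (Ioo_subset_Icc_self hx)).hasDerivWithinAt)
    (hmono.injOn.mono Ioo_subset_Icc_self)
    (fun y => (Φ ℓ - y) ^ (p - 1) * (y - Φ a) ^ (q - 1))
  have hT : 0 < Φ ℓ - Φ a := sub_pos.2 (hmono ha hℓ haℓ)
  have hlt : Φ a ≤ Φ ℓ := by linarith
  calc _ = ∫ x in Ioo a ℓ, |Φ' x| • ((Φ ℓ - Φ x) ^ (p - 1) * (Φ x - Φ a) ^ (q - 1)) := by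
        refine setIntegral_congr_fun measurableSet_Ioo fun x hx => ?_
        simp only [abs_of_pos (hpos x (Ioo_subset_Icc_self hx)), smul_eq_mul, mul_assoc]
    _ = ∫ y in Φ a..Φ ℓ, (Φ ℓ - y) ^ (p - 1) * (y - Φ a) ^ (q - 1) := by
        rw [← hcov, himg, intervalIntegral.integral_of_le hlt, integral_Ioc_eq_integral_Ioo]
    _ = ∫ s in (Φ a - Φ a)..(Φ ℓ - Φ a), s ^ (q - 1) * ((Φ ℓ - Φ a) - s) ^ (p - 1) := by
        rw [← intervalIntegral.integral_comp_sub_right]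
        refine intervalIntegral.integral_congr fun y _ => ?_
        simp only [sub_sub_sub_cancel_right]
        ring
    _ = _ := by rw [sub_self, integral_rpow_mul_sub_rpow hp hq hT]

theorem integrableOn_weighted_beta (haℓ : a < ℓ) (hd : ∀ x ∈ Icc a ℓ, HasDerivAt Φ (Φ' x) x)
    (hpos : ∀ x ∈ Icc a ℓ, 0 < Φ' x) {p q : ℝ} (hp : 0 < p) (hq : 0 < q) :
    IntegrableOn (fun ρ => Φ' ρ * (Φ ℓ - Φ ρ) ^ (p - 1) * (Φ ρ - Φ a) ^ (q - 1)) (Ioo a ℓ) := by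
  by_contra hn
  have h := setIntegral_weighted_beta haℓ hd hpos hp hq
  rw [integral_undef hn] at h
  have hT : 0 < Φ ℓ - Φ a := sub_pos.2 (strictMonoOn_of_hasDerivAt_pos hd hpos
    (left_mem_Icc.2 haℓ.le) (right_mem_Icc.2 haℓ.le) haℓ)
  have := mul_pos (div_pos (mul_pos (Gamma_pos_of_pos hp) (Gamma_pos_of_pos hq))
    (Gamma_pos_of_pos (add_pos hp hq))) (rpow_pos_of_pos hT (p + q - 1))
  linarith

/-- Integrating the kernel against a weakly singular convolution yields the convolution with
the composed kernel. -/
theorem integral_weighted_kernel_comp (haℓ : a < ℓ) (hd : ∀ x ∈ Icc a ℓ, HasDerivAt Φ (Φ' x) x)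
    (hc : ContinuousOn Φ' (Icc a ℓ)) (hpos : ∀ x ∈ Icc a ℓ, 0 < Φ' x) {p q : ℝ} (hp : 0 < p)
    (hq : 0 < q) (hpq : 1 ≤ p + q) {f : ℝ → ℝ} (hf : ContinuousOn f (Icc a ℓ)) :
    IntervalIntegrable (fun ρ => Φ' ρ * (Φ ℓ - Φ ρ) ^ (p - 1) *
        ∫ σ in a..ρ, (Φ ρ - Φ σ) ^ (q - 1) * f σ) volume a ℓ ∧
      ∫ ρ in a..ℓ, Φ' ρ * (Φ ℓ - Φ ρ) ^ (p - 1) * ∫ σ in a..ρ, (Φ ρ - Φ σ) ^ (q - 1) * f σ =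
        Gamma p * Gamma q / Gamma (p + q) *
          ∫ σ in a..ℓ, (Φ ℓ - Φ σ) ^ (p + q - 1) * f σ := by
  set ν := volume.restrict (Ioo a ℓ) with hν
  let F : ℝ → ℝ → ℝ := fun ρ σ =>
    if σ < ρ then Φ' ρ * (Φ ℓ - Φ ρ) ^ (p - 1) * ((Φ ρ - Φ σ) ^ (q - 1) * f σ) else 0
  have hΦc : ContinuousOn Φ (Icc a ℓ) := fun x hx => (hd x hx).continuousAt.continuousWithinAt
  have hmeas : ∀ {g : ℝ → ℝ}, ContinuousOn g (Icc a ℓ) → AEMeasurable g ν := fun hg =>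
    (hg.mono Ioo_subset_Icc_self).aemeasurable measurableSet_Ioo
  have hFm : AEStronglyMeasurable (Function.uncurry F) (ν.prod ν) := by
    have h1 : AEMeasurable (fun x : ℝ × ℝ => Φ' x.1 * (Φ ℓ - Φ x.1) ^ (p - 1) *
        ((Φ x.1 - Φ x.2) ^ (q - 1) * f x.2)) (ν.prod ν) :=
      ((hmeas hc).comp_fst.mul ((aemeasurable_const.sub (hmeas hΦc).comp_fst).pow_const _)).mul
        ((((hmeas hΦc).comp_fst.sub (hmeas hΦc).comp_snd).pow_const _).mul (hmeas hf).comp_snd)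
    have h2 := h1.indicator (measurableSet_lt (measurable_snd (α := ℝ) (β := ℝ)) measurable_fst)
    refine (h2.congr (Filter.Eventually.of_forall fun x => ?_)).aestronglyMeasurable
    simp only [indicator, mem_ofPred_eq, Function.uncurry, F]
  have hsec : ∀ σ ∈ Ioo a ℓ, (Integrable (fun ρ => F ρ σ) ν ∧
      ∫ ρ, F ρ σ ∂ν = Gamma p * Gamma q / Gamma (p + q) * ((Φ ℓ - Φ σ) ^ (p + q - 1) * f σ)) ∧
      ∫ ρ, ‖F ρ σ‖ ∂ν =
        Gamma p * Gamma q / Gamma (p + q) * ((Φ ℓ - Φ σ) ^ (p + q - 1) * |f σ|) := by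
    intro σ hσ
    have hsub : Icc σ ℓ ⊆ Icc a ℓ := Icc_subset_Icc_left hσ.1.le
    have hd' := fun x hx => hd x (hsub hx)
    have hpos' := fun x hx => hpos x (hsub hx)
    have hmono := strictMonoOn_of_hasDerivAt_pos hd' hpos'
    have hset : Ioo a ℓ ∩ Ioi σ = Ioo σ ℓ := by
      ext x; simp only [mem_inter_iff, mem_Ioo, mem_Ioi]
      constructor
      · rintro ⟨⟨_, h2⟩, h3⟩; exact ⟨h3, h2⟩
      · rintro ⟨h1, h2⟩; exact ⟨⟨hσ.1.trans h1, h2⟩, h1⟩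
    have hF : (fun ρ => F ρ σ) = (Ioi σ).indicator
        fun ρ => Φ' ρ * (Φ ℓ - Φ ρ) ^ (p - 1) * (Φ ρ - Φ σ) ^ (q - 1) * f σ := by
      ext ρ; simp only [F, indicator, mem_Ioi, mul_assoc]
    have hI := integrableOn_weighted_beta hσ.2 hd' hpos' hp hq
    have hV := setIntegral_weighted_beta hσ.2 hd' hpos' hp hq
    refine ⟨⟨?_, ?_⟩, ?_⟩
    · rw [hF, integrable_indicator_iff measurableSet_Ioi, IntegrableOn, hν,
        Measure.restrict_restrict measurableSet_Ioi, inter_comm, hset]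
      exact hI.mul_const _
    · rw [hF, hν, setIntegral_indicator measurableSet_Ioi, hset, integral_mul_const, hV]
      ring
    · have hF' : (fun ρ => ‖F ρ σ‖) = (Ioi σ).indicator
          fun ρ => ‖Φ' ρ * (Φ ℓ - Φ ρ) ^ (p - 1) * (Φ ρ - Φ σ) ^ (q - 1) * f σ‖ := by
        ext ρ; rw [congrFun hF ρ, norm_indicator_eq_indicator_norm]
      rw [hF', hν, setIntegral_indicator measurableSet_Ioi, hset, ← mul_assoc, ← hV,
        ← integral_mul_const]
      refine setIntegral_congr_fun measurableSet_Ioo fun ρ hρ => ?_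
      have hρ' := Ioo_subset_Icc_self hρ
      have h1 := hpos' ρ hρ'
      have h2 : 0 ≤ Φ ℓ - Φ ρ :=
        sub_nonneg.2 (hmono hρ' (right_mem_Icc.2 hσ.2.le) hρ.2).le
      have h3 : 0 ≤ Φ ρ - Φ σ :=
        sub_nonneg.2 (hmono (left_mem_Icc.2 hσ.2.le) hρ' hρ.1).le
      simp only [norm_mul, norm_eq_abs]
      rw [abs_of_pos h1, abs_of_nonneg (rpow_nonneg h2 _), abs_of_nonneg (rpow_nonneg h3 _)]
  have hpow : ContinuousOn (fun σ => (Φ ℓ - Φ σ) ^ (p + q - 1)) (Icc a ℓ) :=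
    (continuousOn_const.sub hΦc).rpow_const fun _ _ => Or.inr (by linarith)
  have hintegrable : Integrable (Function.uncurry F) (ν.prod ν) := by
    rw [integrable_prod_iff' hFm]
    constructor
    · exact (ae_restrict_mem measurableSet_Ioo).mono fun σ hσ => (hsec σ hσ).1.1
    · have : IntegrableOn (fun σ => Gamma p * Gamma q / Gamma (p + q) *
          ((Φ ℓ - Φ σ) ^ (p + q - 1) * |f σ|)) (Ioo a ℓ) :=
        ((hpow.mul hf.abs).integrableOn_Icc.mono_set Ioo_subset_Icc_self).const_mul _
      exact this.congr ((ae_restrict_mem measurableSet_Ioo).mono fun σ hσ => (hsec σ hσ).2.symm)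
  have hrow : ∀ ρ ∈ Ioo a ℓ, ∫ σ, F ρ σ ∂ν = Φ' ρ * (Φ ℓ - Φ ρ) ^ (p - 1) *
      ∫ σ in a..ρ, (Φ ρ - Φ σ) ^ (q - 1) * f σ := by
    intro ρ hρ
    have hset : Ioo a ℓ ∩ Iio ρ = Ioo a ρ := by
      ext x; simp only [mem_inter_iff, mem_Ioo, mem_Iio]
      constructor
      · rintro ⟨⟨h1, _⟩, h3⟩; exact ⟨h1, h3⟩
      · rintro ⟨h1, h2⟩; exact ⟨⟨h1, h2.trans hρ.2⟩, h2⟩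
    have hF : (fun σ => F ρ σ) = (Iio ρ).indicator
        fun σ => Φ' ρ * (Φ ℓ - Φ ρ) ^ (p - 1) * ((Φ ρ - Φ σ) ^ (q - 1) * f σ) := by
      ext σ; simp only [F, indicator, mem_Iio]
    rw [hF, hν, setIntegral_indicator measurableSet_Iio, hset, integral_const_mul,
      intervalIntegral.integral_of_le hρ.1.le, integral_Ioc_eq_integral_Ioo]
  constructor
  · rw [intervalIntegrable_iff_integrableOn_Ioo_of_le haℓ.le]
    exact hintegrable.integral_prod_left.congr
      ((ae_restrict_mem measurableSet_Ioo).mono fun ρ hρ => hrow ρ hρ)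
  · rw [intervalIntegral.integral_of_le haℓ.le, integral_Ioc_eq_integral_Ioo,
      ← setIntegral_congr_fun measurableSet_Ioo hrow, integral_integral_swap hintegrable,
      setIntegral_congr_fun measurableSet_Ioo fun σ hσ => (hsec σ hσ).1.2, integral_const_mul,
      intervalIntegral.integral_of_le haℓ.le, integral_Ioc_eq_integral_Ioo]

end weighted

theorem rpow_mul_exp_neg_le_Gamma {A s : ℝ} (hA : 0 < A) (hs : 1 ≤ s) :
    A ^ (s - 1) * exp (-A) ≤ Gamma s := by
  have hs0 : 0 < s := by linarith
  have hintegrable := GammaIntegral_convergent hs0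
  calc A ^ (s - 1) * exp (-A) = ∫ x in Ioi A, exp (-x) * A ^ (s - 1) := by
        rw [integral_mul_const, integral_exp_neg_Ioi, mul_comm]
    _ ≤ ∫ x in Ioi A, exp (-x) * x ^ (s - 1) := by
        refine setIntegral_mono_on ((integrableOn_exp_neg_Ioi A).mul_const _)
          (hintegrable.mono_set (Ioi_subset_Ioi hA.le)) measurableSet_Ioi fun x hx => ?_
        exact mul_le_mul_of_nonneg_left
          (rpow_le_rpow hA.le (mem_Ioi.1 hx).le (by linarith)) (exp_pos _).le
    _ ≤ ∫ x in Ioi 0, exp (-x) * x ^ (s - 1) := by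
        refine setIntegral_mono_set hintegrable ?_ (Ioi_subset_Ioi hA.le).eventuallyLE
        exact (ae_restrict_mem measurableSet_Ioi).mono fun x hx =>
          mul_nonneg (exp_pos _).le (rpow_nonneg (mem_Ioi.1 hx).le _)
    _ = Gamma s := (Gamma_eq_integral hs0).symm

theorem summable_pow_div_Gamma {p : ℝ} (hp : 0 < p) (q x : ℝ) :
    Summable fun k : ℕ => x ^ k / Gamma (p * k + q) := by
  obtain ⟨A, hA, hAp⟩ : ∃ A : ℝ, 0 < A ∧ A ^ p = 2 * (|x| + 1) :=
    ⟨(2 * (|x| + 1)) ^ p⁻¹, by positivity, rpow_inv_rpow (by positivity) hp.ne'⟩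
  have hgeo : Summable fun k : ℕ => (exp A * A ^ (1 - q)) * (1 / 2 : ℝ) ^ k :=
    summable_geometric_two.mul_left _
  refine Summable.of_norm_bounded_eventually_nat hgeo ?_
  obtain ⟨N, hN⟩ := exists_nat_ge ((1 - q) / p)
  filter_upwards [Filter.eventually_ge_atTop N] with k hk
  have hk' : 1 ≤ p * k + q := by
    have : (1 - q) / p ≤ k := hN.trans (by exact_mod_cast hk)
    rw [div_le_iff₀ hp] at this
    linarith
  have hG := rpow_mul_exp_neg_le_Gamma hA hk'
  have hG0 : 0 < Gamma (p * k + q) := Gamma_pos_of_pos (by linarith)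
  have hsplit : A ^ (p * k + q - 1) = (2 * (|x| + 1)) ^ k * A ^ (q - 1) := by
    rw [add_sub_assoc, rpow_add hA, rpow_mul hA.le, hAp, rpow_natCast]
  have hA1 : A ^ (1 - q) * A ^ (q - 1) = 1 := by
    rw [← rpow_add hA]; simp
  have hE : exp A * exp (-A) = 1 := by rw [← exp_add]; simp
  rw [norm_div, norm_pow, norm_eq_abs, norm_eq_abs, abs_of_pos hG0, div_le_iff₀ hG0]
  calc |x| ^ k ≤ (|x| + 1) ^ k := by gcongr; linarith
    _ = (exp A * A ^ (1 - q)) * (1 / 2 : ℝ) ^ k * (A ^ (p * k + q - 1) * exp (-A)) := by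
        rw [hsplit, mul_pow]
        have h2 : (1 / 2 : ℝ) ^ k * 2 ^ k = 1 := by rw [← mul_pow]; norm_num
        calc (|x| + 1) ^ k = (exp A * exp (-A)) * (A ^ (1 - q) * A ^ (q - 1)) *
              ((1 / 2 : ℝ) ^ k * 2 ^ k) * (|x| + 1) ^ k := by rw [hE, hA1, h2]; ring
          _ = _ := by ring
    _ ≤ _ := by gcongr

/-- Explicit representation of the solution of the linear problem
`ᶜD^{μ;Φ}z + ω ᶜD^{κ;Φ}z = H`, `z(a) = z_a`:
`z(ℓ) = z_a + ∫_a^ℓ Φ'(ρ)(Φ(ℓ)−Φ(ρ))^{μ−1} E_{μ−κ,μ}(−ω(Φ(ℓ)−Φ(ρ))^{μ−κ}) H(ρ) dρ`. -/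
theorem linear_problem_representation
    (a b : ℝ) (hab : a < b)
    (Φ Φ' : ℝ → ℝ)
    (hΦd : ∀ x ∈ Icc a b, HasDerivAt Φ (Φ' x) x)
    (hΦ'c : ContinuousOn Φ' (Icc a b))
    (hΦ'pos : ∀ x ∈ Icc a b, 0 < Φ' x)
    (μ κ ω za : ℝ) (hκ0 : 0 < κ) (hκμ : κ < μ) (hμ1 : μ < 1) (hω : 0 < ω)
    (H : ℝ → ℝ) (hH : ContinuousOn H (Icc a b))
    (z z' : ℝ → ℝ)
    (hzd : ∀ x ∈ Icc a b, HasDerivAt z (z' x) x)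
    (hz'c : ContinuousOn z' (Icc a b))
    (hza : z a = za)
    (heq : ∀ ℓ ∈ Icc a b,
      (1 / Real.Gamma (1 - μ)) * (∫ ρ in a..ℓ, (Φ ℓ - Φ ρ) ^ (-μ) * z' ρ)
        + ω * ((1 / Real.Gamma (1 - κ)) * ∫ ρ in a..ℓ, (Φ ℓ - Φ ρ) ^ (-κ) * z' ρ)
      = H ℓ) :
    ∀ ℓ ∈ Icc a b,
      z ℓ = za + ∫ ρ in a..ℓ,
        Φ' ρ * (Φ ℓ - Φ ρ) ^ (μ - 1) *
          mittagLeffler (μ - κ) μ (-ω * (Φ ℓ - Φ ρ) ^ (μ - κ)) * H ρ := by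
  have hδ : 0 < μ - κ := sub_pos.2 hκμ
  have hμ0 : 0 < μ := hκ0.trans hκμ
  intro ℓ hℓ
  rcases hℓ.1.eq_or_lt with rfl | haℓ
  · simp [hza]
  have hsub : Icc a ℓ ⊆ Icc a b := Icc_subset_Icc_right hℓ.2
  have hd := fun x hx => hΦd x (hsub hx)
  have hpos := fun x hx => hΦ'pos x (hsub hx)
  have hc := hΦ'c.mono hsub
  have hzc := hz'c.mono hsub
  have hΦc : ContinuousOn Φ (Icc a ℓ) := fun x hx => (hd x hx).continuousAt.continuousWithinAt
  have hle : ∀ x ∈ Icc a ℓ, 0 ≤ Φ ℓ - Φ x ∧ Φ ℓ - Φ x ≤ Φ ℓ - Φ a := by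
    have hmono := (strictMonoOn_of_hasDerivAt_pos hd hpos).monotoneOn
    intro x hx
    have h1 := hmono hx (right_mem_Icc.2 haℓ.le) hx.2
    have h2 := hmono (left_mem_Icc.2 haℓ.le) hx hx.1
    constructor <;> linarith
  set T := Φ ℓ - Φ a with hT
  set δ := μ - κ with hδdef
  let A : ℕ → ℝ := fun k => (∫ σ in a..ℓ, (Φ ℓ - Φ σ) ^ (δ * k) * z' σ) / Gamma (δ * k + 1)
  have hJ : ∀ k : ℕ, ∫ ρ in a..ℓ, Φ' ρ * (Φ ℓ - Φ ρ) ^ (δ * k + μ - 1) * H ρ =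
      Gamma (δ * k + μ) * (A k + ω * A (k + 1)) := by
    intro k
    have hk : 0 ≤ δ * k := by positivity
    have hp : 0 < δ * k + μ := by positivity
    obtain ⟨i1, e1⟩ := integral_weighted_kernel_comp haℓ hd hc hpos hp (sub_pos.2 hμ1)
      (by linarith) hzc
    obtain ⟨i2, e2⟩ := integral_weighted_kernel_comp haℓ hd hc hpos hp
      (sub_pos.2 (hκμ.trans hμ1)) (by linarith) hzc
    have hG1 := Gamma_pos_of_pos (sub_pos.2 hμ1)
    have hG2 := Gamma_pos_of_pos (sub_pos.2 (hκμ.trans hμ1))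
    calc _ = ∫ ρ in a..ℓ, ((1 / Gamma (1 - μ)) * (Φ' ρ * (Φ ℓ - Φ ρ) ^ (δ * k + μ - 1) *
              ∫ σ in a..ρ, (Φ ρ - Φ σ) ^ (1 - μ - 1) * z' σ) +
            (ω / Gamma (1 - κ)) * (Φ' ρ * (Φ ℓ - Φ ρ) ^ (δ * k + μ - 1) *
              ∫ σ in a..ρ, (Φ ρ - Φ σ) ^ (1 - κ - 1) * z' σ)) := by
          refine intervalIntegral.integral_congr fun ρ hρ => ?_
          rw [uIcc_of_le haℓ.le] at hρ
          simp only [← heq ρ (hsub hρ), sub_sub_cancel_left]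
          ring
      _ = _ := by
          rw [intervalIntegral.integral_add (i1.const_mul _) (i2.const_mul _),
            intervalIntegral.integral_const_mul, intervalIntegral.integral_const_mul, e1, e2]
          have x1 : δ * k + μ + (1 - μ) = δ * k + 1 := by ring
          have x2 : δ * k + μ + (1 - κ) = δ * (k + 1 : ℕ) + 1 := by
            rw [hδdef]; push_cast; ring
          simp only [A]
          rw [x1, x2, add_sub_cancel_right, add_sub_cancel_right]
          field_simp
  obtain ⟨M, hM⟩ := isCompact_Icc.exists_bound_of_continuousOn (hH.mono hsub)
  obtain ⟨N, hN⟩ := isCompact_Icc.exists_bound_of_continuousOn hzc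
  have hN0 : 0 ≤ N := (norm_nonneg _).trans (hN a (left_mem_Icc.2 haℓ.le))
  have hT0 : 0 ≤ T := (hle a (left_mem_Icc.2 haℓ.le)).1
  have hGpos : ∀ k : ℕ, 0 < Gamma (δ * k + μ) := fun k => Gamma_pos_of_pos (by positivity)
  have hsum : HasSum (fun k : ℕ => ∫ ρ in a..ℓ, Φ' ρ * (Φ ℓ - Φ ρ) ^ (μ - 1) *
        ((-ω * (Φ ℓ - Φ ρ) ^ δ) ^ k / Gamma (δ * k + μ)) * H ρ)
      (∫ ρ in a..ℓ, Φ' ρ * (Φ ℓ - Φ ρ) ^ (μ - 1) *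
        mittagLeffler δ μ (-ω * (Φ ℓ - Φ ρ) ^ δ) * H ρ) := by
    refine intervalIntegral.hasSum_integral_of_dominated_convergence
      (fun k ρ => Φ' ρ * (Φ ℓ - Φ ρ) ^ (μ - 1) * M * ((ω * T ^ δ) ^ k / Gamma (δ * k + μ)))
      (fun k => ?_) (fun k => ?_) ?_ ?_ ?_
    · have hm : ∀ {g : ℝ → ℝ}, ContinuousOn g (Icc a ℓ) →
          AEMeasurable g (volume.restrict (uIoc a ℓ)) := fun hg => by
        rw [uIoc_of_le haℓ.le]
        exact (hg.mono Ioc_subset_Icc_self).aemeasurable measurableSet_Ioc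
      have hm' := (hm hΦc).const_sub (Φ ℓ)
      exact ((((hm hc).mul (hm'.pow_const _)).mul
        ((((hm'.pow_const _).const_mul _).pow_const _).div_const _)).mul
        (hm (hH.mono hsub))).aestronglyMeasurable
    · refine Filter.Eventually.of_forall fun ρ hρ => ?_
      rw [uIoc_of_le haℓ.le] at hρ
      have hρ' := Ioc_subset_Icc_self hρ
      obtain ⟨h1, h2⟩ := hle ρ hρ'
      have h3 := hpos ρ hρ'
      have h4 := hM ρ hρ'
      have h5 := hGpos k
      simp only [norm_mul, norm_div, norm_pow, norm_neg, norm_eq_abs] at h4 ⊢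
      rw [abs_of_pos h3, abs_of_pos h5, abs_of_pos hω, abs_of_nonneg (rpow_nonneg h1 _),
        abs_of_nonneg (rpow_nonneg h1 _), mul_right_comm]
      have h6 := rpow_nonneg h1 (μ - 1)
      have h7 := rpow_nonneg h1 δ
      have h8 := rpow_le_rpow h1 h2 hδ.le
      gcongr
      exact mul_nonneg (mul_nonneg h3.le h6) ((abs_nonneg _).trans h4)
    · exact Filter.Eventually.of_forall fun ρ _ => (summable_pow_div_Gamma hδ μ _).mul_left _
    · simp only [tsum_mul_left]
      refine (IntervalIntegrable.mul_const ?_ _).mul_const _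
      rw [intervalIntegrable_iff_integrableOn_Ioo_of_le haℓ.le]
      simpa using integrableOn_weighted_beta haℓ hd hpos hμ0 one_pos
    · exact Filter.Eventually.of_forall fun ρ _ =>
        ((summable_pow_div_Gamma hδ μ _).hasSum.mul_left _).mul_right _
  have hterm : ∀ k : ℕ, ∫ ρ in a..ℓ, Φ' ρ * (Φ ℓ - Φ ρ) ^ (μ - 1) *
        ((-ω * (Φ ℓ - Φ ρ) ^ δ) ^ k / Gamma (δ * k + μ)) * H ρ =
      (-ω) ^ k * A k - (-ω) ^ (k + 1) * A (k + 1) := by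
    intro k
    calc _ = ∫ ρ in a..ℓ, ((-ω) ^ k / Gamma (δ * k + μ)) *
            (Φ' ρ * (Φ ℓ - Φ ρ) ^ (δ * k + μ - 1) * H ρ) := by
          rw [intervalIntegral.integral_of_le haℓ.le, intervalIntegral.integral_of_le haℓ.le,
            integral_Ioc_eq_integral_Ioo, integral_Ioc_eq_integral_Ioo]
          refine setIntegral_congr_fun measurableSet_Ioo fun ρ hρ => ?_
          have h1 : 0 < Φ ℓ - Φ ρ := sub_pos.2 (strictMonoOn_of_hasDerivAt_pos hd hpos
            (Ioo_subset_Icc_self hρ) (right_mem_Icc.2 haℓ.le) hρ.2)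
          simp only [add_sub_assoc]
          rw [rpow_add h1, rpow_mul h1.le, rpow_natCast, mul_pow]
          ring
      _ = _ := by
          have := (hGpos k).ne'
          rw [intervalIntegral.integral_const_mul, hJ k]
          field_simp
          ring
  have hlim : Filter.Tendsto (fun k => (-ω) ^ k * A k) Filter.atTop (nhds 0) := by
    have h0 := ((summable_pow_div_Gamma hδ 1 (ω * T ^ δ)).tendsto_atTop_zero.const_mul
      (N * |ℓ - a|))
    rw [mul_zero] at h0
    refine squeeze_zero_norm (fun k => ?_) h0
    have hG : 0 < Gamma (δ * k + 1) := Gamma_pos_of_pos (by positivity)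
    have hI : ‖∫ σ in a..ℓ, (Φ ℓ - Φ σ) ^ (δ * k) * z' σ‖ ≤ T ^ (δ * k) * N * |ℓ - a| := by
      refine intervalIntegral.norm_integral_le_of_norm_le_const fun σ hσ => ?_
      rw [uIoc_of_le haℓ.le] at hσ
      obtain ⟨h1, h2⟩ := hle σ (Ioc_subset_Icc_self hσ)
      rw [norm_mul, norm_of_nonneg (rpow_nonneg h1 _)]
      exact mul_le_mul (rpow_le_rpow h1 h2 (by positivity)) (hN σ (Ioc_subset_Icc_self hσ))
        (norm_nonneg _) (rpow_nonneg hT0 _)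
    simp only [A, norm_mul, norm_div, norm_pow, norm_neg, norm_of_nonneg hω.le,
      norm_of_nonneg hG.le]
    calc _ ≤ ω ^ k * (T ^ (δ * k) * N * |ℓ - a| / Gamma (δ * k + 1)) := by gcongr
      _ = _ := by rw [rpow_mul hT0, rpow_natCast, mul_pow]; ring
  have hpart := hsum.tendsto_sum_nat
  simp only [hterm, Finset.sum_range_sub'] at hpart
  have hA0 : A 0 = z ℓ - z a := by
    simp only [A, Nat.cast_zero, mul_zero, rpow_zero, one_mul, zero_add, Gamma_one, div_one]
    rw [← uIcc_of_le haℓ.le] at hzc hsub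
    exact intervalIntegral.integral_eq_sub_of_hasDerivAt (fun x hx => hzd x (hsub hx))
      hzc.intervalIntegrable
  have huniq := tendsto_nhds_unique hpart (hlim.const_sub ((-ω) ^ 0 * A 0))
  rw [huniq, hA0, ← hza]
  ring
end

section
/- Continuous dependence on initial data: Let 0 < κ < μ < 1, ω > 0, and let F : [a,b] × ℝ → ℝ be continuous with |F(ℓ,y) − F(ℓ,x)| ≤ L|y − x| for all ℓ ∈ [a,b] and x, y ∈ ℝ, for some L > 0. Suppose z, z̄ : [a,b] → ℝ are continuous and satisfy z(ℓ) = z_a + ∫_a^ℓ Φ'(ρ)(Φ(ℓ)−Φ(ρ))^{μ−1} E_{μ−κ,μ}(−ω(Φ(ℓ)−Φ(ρ))^{μ−κ}) F(ρ, z(ρ)) dρ and z̄(ℓ) = z̄_a + ∫_a^ℓ Φ'(ρ)(Φ(ℓ)−Φ(ρ))^{μ−1} E_{μ−κ,μ}(−ω(Φ(ℓ)−Φ(ρ))^{μ−κ}) F(ρ, z̄(ρ)) dρ for all ℓ ∈ [a,b]. Then sup_{ℓ∈[a,b]} |z(ℓ) − z̄(ℓ)| ≤ E_μ( L (Φ(b)−Φ(a))^μ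 ) · |z_a − z̄_a|. -/
open Real MeasureTheory Set

theorem intervalIntegrable_of_integral_ne_zero {f : ℝ → ℝ} {a b : ℝ}
    (h : ∫ x in a..b, f x ≠ 0) : IntervalIntegrable f volume a b := by
  contrapose! h
  exact intervalIntegral.integral_undef h

theorem integral_sub_rpow_mul_rpow {p q t : ℝ} (hp : 0 < p) (hq : 0 < q) (ht : 0 < t) :
    ∫ s in (0 : ℝ)..t, (t - s) ^ (p - 1) * s ^ (q - 1) =
      t ^ (p + q - 1) * (Gamma p * Gamma q / Gamma (p + q)) := by
  have h1 := Complex.betaIntegral_scaled (q : ℂ) (p : ℂ) ht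
  have h2 := Complex.Gamma_mul_Gamma_eq_betaIntegral (s := (q : ℂ)) (t := (p : ℂ))
    (by simpa using hq) (by simpa using hp)
  have hG : Gamma (p + q) ≠ 0 := (Gamma_pos_of_pos (by positivity)).ne'
  have h3 : (∫ x in (0 : ℝ)..t, (x : ℂ) ^ ((q : ℂ) - 1) * ((t : ℂ) - x) ^ ((p : ℂ) - 1)) =
      ((∫ s in (0 : ℝ)..t, (t - s) ^ (p - 1) * s ^ (q - 1) : ℝ) : ℂ) := by
    rw [← intervalIntegral.integral_ofReal]
    refine intervalIntegral.integral_congr fun x hx => ?_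
    rw [uIcc_of_le ht.le] at hx
    have hx' : 0 ≤ t - x := sub_nonneg.2 hx.2
    simp only [Complex.ofReal_mul, Complex.ofReal_cpow hx.1, Complex.ofReal_cpow hx',
      Complex.ofReal_sub, Complex.ofReal_one]
    ring
  rw [h3] at h1
  have h4 : Complex.betaIntegral q p = ((Gamma p * Gamma q / Gamma (p + q) : ℝ) : ℂ) := by
    have hG' : ((Gamma (p + q) : ℝ) : ℂ) ≠ 0 := by exact_mod_cast hG
    rw [← Complex.ofReal_add, Complex.Gamma_ofReal, Complex.Gamma_ofReal, Complex.Gamma_ofReal,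
      add_comm q p] at h2
    push_cast
    rw [eq_div_iff hG', mul_comm, ← h2, mul_comm]
  rw [h4] at h1
  have h5 : ((t : ℂ)) ^ ((q : ℂ) + p - 1) = ((t ^ (p + q - 1) : ℝ) : ℂ) := by
    rw [Complex.ofReal_cpow ht.le]
    push_cast
    ring_nf
  rw [h5] at h1
  exact_mod_cast h1

theorem intervalIntegrable_sub_rpow_mul_rpow {p q t : ℝ} (hp : 0 < p) (hq : 0 < q)
    (ht : 0 < t) :
    IntervalIntegrable (fun s => (t - s) ^ (p - 1) * s ^ (q - 1)) volume 0 t := by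
  apply intervalIntegrable_of_integral_ne_zero
  rw [integral_sub_rpow_mul_rpow hp hq ht]
  have := Gamma_pos_of_pos hp
  have := Gamma_pos_of_pos hq
  have := Gamma_pos_of_pos (add_pos hp hq)
  positivity

theorem summable_mittagLeffler {p q : ℝ} (hp : 0 < p) (hq : 0 < q) (x : ℝ) :
    Summable fun k : ℕ => x ^ k / Gamma (p * k + q) := by
  set A : ℝ := (2 * |x| + 1) ^ p⁻¹ with hAdef
  have hx1 : 0 < 2 * |x| + 1 := by positivity
  have hA : 0 < A := by positivity
  have hAp : A ^ p = 2 * |x| + 1 := by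
    rw [hAdef, ← rpow_mul hx1.le, inv_mul_cancel₀ hp.ne', rpow_one]
  set r : ℝ := |x| / (2 * |x| + 1)
  have hr0 : 0 ≤ r := by positivity
  have hr1 : r < 1 := by
    rw [div_lt_one hx1]
    linarith [abs_nonneg x]
  have hgeo : Summable fun k : ℕ => (A ^ (q - 1) * exp (-A))⁻¹ * r ^ k :=
    (summable_geometric_of_lt_one hr0 hr1).mul_left _
  refine summable_of_isBigO_nat hgeo (Asymptotics.IsBigO.of_bound 1 ?_)
  obtain ⟨N, hN⟩ := exists_nat_gt (1 / p)
  filter_upwards [Filter.eventually_ge_atTop N] with k hk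
  have hk1 : 1 ≤ p * k + q := by
    have : (N : ℝ) ≤ k := by exact_mod_cast hk
    have : 1 < k * p := (div_lt_iff₀ hp).1 (hN.trans_le this)
    linarith
  have hG := rpow_mul_exp_neg_le_Gamma hA hk1
  have hGp : 0 < Gamma (p * k + q) := Gamma_pos_of_pos (by linarith)
  have hsplit : A ^ (p * k + q - 1) = (2 * |x| + 1) ^ k * A ^ (q - 1) := by
    rw [add_sub_assoc, rpow_add hA, rpow_mul hA.le, hAp, rpow_natCast]
  rw [hsplit] at hG
  have hc : 0 < A ^ (q - 1) * exp (-A) := by positivity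
  have hc' : 0 ≤ (A ^ (q - 1) * exp (-A))⁻¹ * r ^ k := by positivity
  rw [one_mul, norm_div, norm_pow, norm_eq_abs, norm_eq_abs, norm_eq_abs, abs_of_pos hGp,
    abs_of_nonneg hc']
  calc |x| ^ k / Gamma (p * k + q) ≤ |x| ^ k / ((2 * |x| + 1) ^ k * A ^ (q - 1) * exp (-A)) := by
        gcongr
    _ = _ := by
        simp only [r, div_pow]
        field_simp

theorem continuous_mittagLeffler {p q : ℝ} (hp : 0 < p) (hq : 0 < q) :
    Continuous (mittagLeffler p q) := by
  rw [continuous_iff_continuousAt]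
  intro x
  have : ContinuousOn (mittagLeffler p q) (Icc (-(|x| + 1)) (|x| + 1)) := by
    refine continuousOn_tsum (fun k => by fun_prop)
      (summable_mittagLeffler hp hq (|x| + 1)) fun k y hy => ?_
    have hG : 0 < Gamma (p * k + q) := Gamma_pos_of_pos (by positivity)
    rw [norm_div, norm_pow, norm_eq_abs, norm_eq_abs, abs_of_pos hG]
    gcongr
    exact abs_le.2 hy
  refine this.continuousAt (Icc_mem_nhds ?_ ?_)
  · linarith [neg_abs_le x]
  · linarith [le_abs_self x]

theorem mittagLeffler_eq_add_mul {p q : ℝ} (hp : 0 < p) (hq : 0 < q) (x : ℝ) :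
    mittagLeffler p q x = (Gamma q)⁻¹ + x * mittagLeffler p (p + q) x := by
  unfold mittagLeffler
  rw [(summable_mittagLeffler hp hq x).tsum_eq_zero_add, ← tsum_mul_left]
  congr 1
  · simp
  · refine tsum_congr fun k => ?_
    rw [pow_succ', mul_div_assoc]
    push_cast
    ring_nf

theorem mittagLeffler_zero (p q : ℝ) : mittagLeffler p q 0 = (Gamma q)⁻¹ := by
  unfold mittagLeffler
  rw [tsum_eq_single 0 (fun k hk => by simp [hk])]
  simp

/-- The Riemann–Liouville fractional integral of order `α` (up to the factor `Γ(α)`) raises the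
second parameter of `s ^ (β - 1) * E_{α,β}(-ω s ^ α)` by `α`. -/
theorem integral_sub_rpow_mul_mittagLeffler {α β ω t : ℝ} (hα : 0 < α) (hβ : 0 < β)
    (ht : 0 < t) :
    ∫ s in (0 : ℝ)..t, (t - s) ^ (α - 1) * (s ^ (β - 1) * mittagLeffler α β (-ω * s ^ α)) =
      Gamma α * (t ^ (α + β - 1) * mittagLeffler α (α + β) (-ω * t ^ α)) := by
  have hG : ∀ k : ℕ, 0 < Gamma (α * k + β) := fun k => Gamma_pos_of_pos (by positivity)
  have hGα := Gamma_pos_of_pos hα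
  let c : ℕ → ℝ := fun k => (-ω) ^ k / Gamma (α * k + β)
  let f : ℕ → ℝ → ℝ := fun k s => c k * ((t - s) ^ (α - 1) * s ^ (α * k + β - 1))
  have hbeta : ∀ k : ℕ, ∫ s in (0 : ℝ)..t, (t - s) ^ (α - 1) * s ^ (α * k + β - 1) =
      t ^ (α + β - 1) * (Gamma α * Gamma (α * k + β)) * ((t ^ α) ^ k /
        Gamma (α * k + (α + β))) := by
    intro k
    rw [integral_sub_rpow_mul_rpow hα (by positivity) ht]
    have h1 : t ^ (α + (α * k + β) - 1) = t ^ (α + β - 1) * (t ^ α) ^ k := by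
      rw [← rpow_natCast, ← rpow_mul ht.le, ← rpow_add ht]
      ring_nf
    rw [h1, show α + (α * k + β) = α * k + (α + β) by ring]
    ring
  have hint : ∀ k, Integrable (f k) (volume.restrict (Ioc 0 t)) := fun k =>
    ((intervalIntegrable_iff_integrableOn_Ioc_of_le ht.le).1
      (intervalIntegrable_sub_rpow_mul_rpow hα (by positivity) ht)).const_mul _
  have hnorm : ∀ k, ∫ s in Ioc 0 t, ‖f k s‖ = Gamma α * t ^ (α + β - 1) *
      ((|ω| * t ^ α) ^ k / Gamma (α * k + (α + β))) := by
    intro k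
    have : ∫ s in Ioc 0 t, ‖f k s‖ =
        ∫ s in Ioc 0 t, |c k| * ((t - s) ^ (α - 1) * s ^ (α * k + β - 1)) := by
      refine setIntegral_congr_fun measurableSet_Ioc fun s hs => ?_
      have h1 : 0 ≤ t - s := sub_nonneg.2 hs.2
      have h2 : 0 ≤ s := hs.1.le
      simp only [f, norm_mul, norm_eq_abs]
      rw [abs_of_nonneg (rpow_nonneg h1 _), abs_of_nonneg (rpow_nonneg h2 _)]
    rw [this, integral_const_mul, ← intervalIntegral.integral_of_le ht.le, hbeta]
    simp only [c, abs_div, abs_pow, abs_neg, abs_of_pos (hG k), mul_pow]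
    have := (hG k).ne'
    field_simp
  have hsum := hasSum_integral_of_summable_integral_norm hint (by
    simp_rw [hnorm]
    exact (summable_mittagLeffler hα (by positivity) _).mul_left _)
  rw [intervalIntegral.integral_of_le ht.le]
  have h1 : ∫ s in Ioc 0 t, (t - s) ^ (α - 1) * (s ^ (β - 1) * mittagLeffler α β (-ω * s ^ α)) =
      ∫ s in Ioc 0 t, ∑' k, f k s := by
    refine setIntegral_congr_fun measurableSet_Ioc fun s hs => ?_
    have h2 : 0 < s := hs.1
    simp only [mittagLeffler, ← tsum_mul_left]
    refine tsum_congr fun k => ?_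
    have h3 : s ^ (α * k + β - 1) = s ^ (β - 1) * (s ^ α) ^ k := by
      rw [← rpow_natCast, ← rpow_mul h2.le, ← rpow_add h2]
      ring_nf
    simp only [f, c, h3, mul_pow]
    ring
  rw [h1, ← hsum.tsum_eq, mittagLeffler, ← tsum_mul_left, ← tsum_mul_left]
  refine tsum_congr fun k => ?_
  simp only [f]
  rw [integral_const_mul, ← intervalIntegral.integral_of_le ht.le, hbeta, mul_pow]
  have := (hG k).ne'
  simp only [c]
  field_simp

theorem rpow_mul_mittagLeffler_eq {α β t : ℝ} (hα : 0 < α) (hβ : 0 < β) (ht : 0 < t) :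
    Gamma α * (t ^ (β - 1) * mittagLeffler α β (-t ^ α)) =
      Gamma α * (t ^ (β - 1) / Gamma β) -
        ∫ s in (0 : ℝ)..t, (t - s) ^ (α - 1) * (s ^ (β - 1) * mittagLeffler α β (-s ^ α)) := by
  have h := integral_sub_rpow_mul_mittagLeffler (ω := 1) hα hβ ht
  simp only [neg_one_mul] at h
  rw [h, mittagLeffler_eq_add_mul hα hβ (-t ^ α),
    show t ^ (α + β - 1) = t ^ (β - 1) * t ^ α by rw [← rpow_add ht]; ring_nf]
  ring

theorem intervalIntegrable_sub_rpow_mul_mittagLeffler {α β t : ℝ} (hα : 0 < α) (hβ : 0 < β)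
    (ht : 0 < t) :
    IntervalIntegrable
      (fun s => (t - s) ^ (α - 1) * (s ^ (β - 1) * mittagLeffler α β (-s ^ α))) volume 0 t := by
  simp only [← mul_assoc]
  refine (intervalIntegrable_sub_rpow_mul_rpow hα hβ ht).mul_continuousOn ?_
  exact ((continuous_mittagLeffler hα hβ).comp
    (continuous_id.rpow_const fun _ => Or.inr hα.le).neg).continuousOn

theorem sub_rpow_le_div_rpow_mul {α s t T : ℝ} (hα1 : α ≤ 1) (hs : 0 ≤ s)
    (hst : s < t) (htT : t ≤ T) :
    (T - s) ^ (α - 1) ≤ (t / T) ^ (1 - α) * (t - s) ^ (α - 1) := by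
  have hts : 0 < t - s := sub_pos.2 hst
  have hTs : 0 < T - s := by linarith
  have hT : 0 < T := by linarith
  have h : ((t - s) / (T - s)) ^ (1 - α) ≤ (t / T) ^ (1 - α) := by
    refine rpow_le_rpow (by positivity) ?_ (by linarith)
    rw [div_le_div_iff₀ hTs hT]
    nlinarith
  rw [div_rpow hts.le hTs.le] at h
  rw [show α - 1 = -(1 - α) by ring, rpow_neg hTs.le, rpow_neg hts.le]
  have h1 : 0 < (t - s) ^ (1 - α) := by positivity
  have h2 : 0 < (T - s) ^ (1 - α) := by positivity
  rw [div_le_iff₀ h2] at h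
  rw [← div_eq_mul_inv, le_div_iff₀ h1, inv_mul_le_iff₀ h2]
  linarith

theorem integral_sub_rpow {α t T : ℝ} (hα : 0 < α) :
    ∫ s in t..T, (T - s) ^ (α - 1) = (T - t) ^ α / α := by
  rw [intervalIntegral.integral_comp_sub_left (fun x => x ^ (α - 1)) T,
    integral_rpow (Or.inl (by linarith))]
  simp [hα.ne']

/-- The function `t ^ (β - 1) * E_{α,β}(-t ^ α)` has no first zero on `(0, ∞)`. -/
theorem rpow_mul_mittagLeffler_pos_of_forall_lt {α β T : ℝ} (hα : 0 < α) (hα1 : α ≤ 1)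
    (hαβ : α ≤ β) (hT : 0 < T)
    (hpos : ∀ t ∈ Ioo 0 T, 0 < t ^ (β - 1) * mittagLeffler α β (-t ^ α)) :
    0 < T ^ (β - 1) * mittagLeffler α β (-T ^ α) := by
  have hβ : 0 < β := hα.trans_le hαβ
  have hGα := Gamma_pos_of_pos hα
  have hGβ := Gamma_pos_of_pos hβ
  by_contra! hTle
  set e : ℝ → ℝ := fun t => t ^ (β - 1) * mittagLeffler α β (-t ^ α) with he
  obtain ⟨t₀, ht₀, ht₀0, ht₀T⟩ : ∃ t₀, 0 < Gamma α * (t₀ / T) ^ (1 - α) - (T - t₀) ^ α / α ∧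
      0 < t₀ ∧ t₀ < T := by
    have hc : ContinuousAt (fun t => Gamma α * (t / T) ^ (1 - α) - (T - t) ^ α / α) T := by
      refine ContinuousAt.sub (continuousAt_const.mul ?_) (ContinuousAt.div_const ?_ _)
      · exact (continuousAt_id.div_const T).rpow_const (Or.inr (by linarith))
      · exact (continuousAt_const.sub continuousAt_id).rpow_const (Or.inr hα.le)
    have h1 : ∀ᶠ t in nhds T, 0 < Gamma α * (t / T) ^ (1 - α) - (T - t) ^ α / α := by
      refine hc.eventually_const_lt ?_
      simpa [hT.ne', hα.ne', zero_rpow] using hGα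
    have h2 : ∀ᶠ t in nhdsWithin T (Iio T), 0 < t ∧ t < T := Ioo_mem_nhdsLT hT
    exact ((h1.filter_mono nhdsWithin_le_nhds).and h2).exists
  have hcont : ContinuousOn e (Icc t₀ T) := by
    refine ContinuousOn.mul ?_ ?_
    · exact continuousOn_id.rpow_const fun x hx => Or.inl (ht₀0.trans_le hx.1).ne'
    · exact ((continuous_mittagLeffler hα hβ).comp
        (continuous_id.rpow_const fun _ => Or.inr hα.le).neg).continuousOn
  obtain ⟨t, ht, hmax⟩ := isCompact_Icc.exists_isMaxOn (nonempty_Icc.2 ht₀T.le) hcont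
  have hM : 0 < e t := (hpos t₀ ⟨ht₀0, ht₀T⟩).trans_le (hmax (left_mem_Icc.2 ht₀T.le))
  have htT : t < T := lt_of_le_of_ne ht.2 (by rintro rfl; exact absurd hM hTle.not_gt)
  have ht0 : 0 < t := ht₀0.trans_le ht.1
  have hiT := intervalIntegrable_sub_rpow_mul_mittagLeffler hα hβ hT
  have hit := intervalIntegrable_sub_rpow_mul_mittagLeffler hα hβ ht0
  have hi1 := hiT.mono_set (c := 0) (d := t)
    (by rw [uIcc_of_le ht0.le, uIcc_of_le hT.le]; exact Icc_subset_Icc_right htT.le)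
  have hi2 := hiT.mono_set (c := t) (d := T)
    (by rw [uIcc_of_le htT.le, uIcc_of_le hT.le]; exact Icc_subset_Icc_left ht0.le)
  have hb1 : ∫ s in (0 : ℝ)..t, (T - s) ^ (α - 1) * e s ≤
      (t / T) ^ (1 - α) * ∫ s in (0 : ℝ)..t, (t - s) ^ (α - 1) * e s := by
    rw [← intervalIntegral.integral_const_mul]
    refine intervalIntegral.integral_mono_on_of_le_Ioo ht0.le hi1 (hit.const_mul _) fun s hs => ?_
    rw [← mul_assoc ((t / T) ^ (1 - α))]
    exact mul_le_mul_of_nonneg_right (sub_rpow_le_div_rpow_mul hα1 hs.1.le hs.2 htT.le)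
      (hpos s ⟨hs.1, hs.2.trans htT⟩).le
  have hb2 : ∫ s in t..T, (T - s) ^ (α - 1) * e s ≤ (T - t) ^ α / α * e t := by
    rw [← integral_sub_rpow hα, ← intervalIntegral.integral_mul_const]
    refine intervalIntegral.integral_mono_on_of_le_Ioo htT.le hi2 ?_ fun s hs => ?_
    · refine IntervalIntegrable.mul_const ?_ _
      apply intervalIntegrable_of_integral_ne_zero
      rw [integral_sub_rpow hα]
      have := sub_pos.2 htT
      positivity
    · exact mul_le_mul_of_nonneg_left (hmax ⟨ht.1.trans hs.1.le, hs.2.le⟩)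
        (rpow_nonneg (sub_nonneg.2 hs.2.le) _)
  have hsplit := intervalIntegral.integral_add_adjacent_intervals hi1 hi2
  have heT := rpow_mul_mittagLeffler_eq hα hβ hT
  have het := rpow_mul_mittagLeffler_eq hα hβ ht0
  have hfree : (t / T) ^ (1 - α) * t ^ (β - 1) ≤ T ^ (β - 1) := by
    have h1 : t ^ (1 - α) * t ^ (β - 1) ≤ T ^ (1 - α) * T ^ (β - 1) := by
      rw [← rpow_add ht0, ← rpow_add hT]
      exact rpow_le_rpow ht0.le htT.le (by linarith)
    have h2 : 0 < T ^ (1 - α) := by positivity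
    rw [div_rpow ht0.le hT.le, div_mul_eq_mul_div, div_le_iff₀ h2]
    linarith
  have hr1 : (t₀ / T) ^ (1 - α) ≤ (t / T) ^ (1 - α) :=
    rpow_le_rpow (by positivity) (by gcongr; exact ht.1) (by linarith)
  have hr2 : (T - t) ^ α / α ≤ (T - t₀) ^ α / α := by
    have := sub_pos.2 htT
    have := ht.1
    gcongr
  have hkey : 0 < Gamma α * (t / T) ^ (1 - α) - (T - t) ^ α / α := by
    have := mul_le_mul_of_nonneg_left hr1 hGα.le
    linarith
  have hkeyM := mul_pos hkey hM
  have hfree' := mul_le_mul_of_nonneg_left hfree (div_pos hGα hGβ).le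
  have hTle' : Gamma α * e T ≤ 0 := mul_nonpos_of_nonneg_of_nonpos hGα.le hTle
  change Gamma α * e t = _ - ∫ s in (0 : ℝ)..t, (t - s) ^ (α - 1) * e s at het
  change Gamma α * e T = _ - ∫ s in (0 : ℝ)..T, (T - s) ^ (α - 1) * e s at heT
  have hIt : ∫ s in (0 : ℝ)..t, (t - s) ^ (α - 1) * e s =
    Gamma α * (t ^ (β - 1) / Gamma β) - Gamma α * e t := by linarith
  rw [hIt] at hb1
  change (∫ s in (0 : ℝ)..t, (T - s) ^ (α - 1) * e s) + (∫ s in t..T, (T - s) ^ (α - 1) * e s) =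
    ∫ s in (0 : ℝ)..T, (T - s) ^ (α - 1) * e s at hsplit
  have e1 : Gamma α / Gamma β * T ^ (β - 1) = Gamma α * (T ^ (β - 1) / Gamma β) := by ring
  have e2 : Gamma α / Gamma β * ((t / T) ^ (1 - α) * t ^ (β - 1)) =
    (t / T) ^ (1 - α) * (Gamma α * (t ^ (β - 1) / Gamma β)) := by ring
  rw [e1, e2] at hfree'
  linarith

theorem mittagLeffler_neg_pos {α β x : ℝ} (hα : 0 < α) (hα1 : α ≤ 1) (hαβ : α ≤ β)
    (hx : 0 ≤ x) : 0 < mittagLeffler α β (-x) := by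
  have hβ : 0 < β := hα.trans_le hαβ
  by_contra! hxle
  have hcont : Continuous fun y => mittagLeffler α β (-y) :=
    (continuous_mittagLeffler hα hβ).comp continuous_neg
  have hS : IsCompact (Icc 0 x ∩ {y | mittagLeffler α β (-y) ≤ 0}) :=
    isCompact_Icc.inter_right (isClosed_le hcont continuous_const)
  obtain ⟨X, ⟨⟨hX0, hXx⟩, hX⟩, hleast⟩ := hS.exists_isLeast ⟨x, ⟨hx, le_rfl⟩, hxle⟩
  have hXpos : 0 < X := by
    refine lt_of_le_of_ne hX0 ?_
    rintro rfl
    have : 0 < mittagLeffler α β (-0) := by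
      rw [neg_zero, mittagLeffler_zero]
      exact inv_pos.2 (Gamma_pos_of_pos hβ)
    exact absurd this (not_lt.2 hX)
  set T : ℝ := X ^ α⁻¹ with hTdef
  have hT : 0 < T := by positivity
  have hTα : T ^ α = X := rpow_inv_rpow hX0 hα.ne'
  have h := rpow_mul_mittagLeffler_pos_of_forall_lt hα hα1 hαβ hT fun t ht => by
    have ht0 : 0 < t := ht.1
    have htX : t ^ α < X := hTα ▸ rpow_lt_rpow ht0.le ht.2 hα
    refine mul_pos (by positivity) ?_
    by_contra! hle
    exact absurd (hleast ⟨⟨by positivity, htX.le.trans hXx⟩, hle⟩) htX.not_ge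
  rw [hTα] at h
  exact absurd (pos_of_mul_pos_right h (by positivity)) (not_lt.2 hX)

theorem abs_mittagLeffler_neg_le {α β x : ℝ} (hα : 0 < α) (hα1 : α ≤ 1) (hαβ : α ≤ β)
    (hx : 0 ≤ x) : |mittagLeffler α β (-x)| ≤ (Gamma β)⁻¹ := by
  have hβ : 0 < β := hα.trans_le hαβ
  rw [abs_of_pos (mittagLeffler_neg_pos hα hα1 hαβ hx), mittagLeffler_eq_add_mul hα hβ]
  have := mul_nonneg hx (mittagLeffler_neg_pos (β := α + β) hα hα1 (by linarith) hx).le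
  linarith

theorem integral_deriv_mul_sub_rpow_mul_rpow {Φ Φ' : ℝ → ℝ} {a b p q : ℝ} (hab : a ≤ b)
    (hΦd : ∀ x ∈ Icc a b, HasDerivAt Φ (Φ' x) x) (hΦ' : ∀ x ∈ Icc a b, 0 ≤ Φ' x)
    (hΦ : Φ a < Φ b) (hp : 0 < p) (hq : 0 < q) :
    ∫ ρ in a..b, Φ' ρ * (Φ b - Φ ρ) ^ (p - 1) * (Φ ρ - Φ a) ^ (q - 1) =
      (Φ b - Φ a) ^ (p + q - 1) * (Gamma p * Gamma q / Gamma (p + q)) := by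
  rw [← integral_sub_rpow_mul_rpow hp hq (sub_pos.2 hΦ)]
  have h1 := intervalIntegral.integral_comp_mul_deriv_of_deriv_nonneg (a := a) (b := b)
    (f := Φ) (f' := Φ') (g := fun u => (Φ b - u) ^ (p - 1) * (u - Φ a) ^ (q - 1))
    (fun x hx => (hΦd x (by rwa [uIcc_of_le hab] at hx)).continuousAt.continuousWithinAt)
    (fun x hx => hΦd x (by
      rw [min_eq_left hab, max_eq_right hab] at hx
      exact Ioo_subset_Icc_self hx))
    (fun x hx => hΦ' x (by
      rw [min_eq_left hab, max_eq_right hab] at hx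
      exact Ioo_subset_Icc_self hx))
  have h2 := intervalIntegral.integral_comp_sub_right (a := Φ a) (b := Φ b)
    (fun s => (Φ b - Φ a - s) ^ (p - 1) * s ^ (q - 1)) (Φ a)
  simp only [sub_sub_sub_cancel_right, sub_self] at h2
  rw [← h2, ← h1]
  refine intervalIntegral.integral_congr fun x _ => ?_
  simp only [Function.comp]
  ring

theorem intervalIntegrable_deriv_mul_sub_rpow_mul_rpow {Φ Φ' : ℝ → ℝ} {a b p q : ℝ}
    (hab : a ≤ b) (hΦd : ∀ x ∈ Icc a b, HasDerivAt Φ (Φ' x) x)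
    (hΦ' : ∀ x ∈ Icc a b, 0 ≤ Φ' x) (hΦ : Φ a < Φ b) (hp : 0 < p) (hq : 0 < q) :
    IntervalIntegrable (fun ρ => Φ' ρ * (Φ b - Φ ρ) ^ (p - 1) * (Φ ρ - Φ a) ^ (q - 1))
      volume a b := by
  apply intervalIntegrable_of_integral_ne_zero
  rw [integral_deriv_mul_sub_rpow_mul_rpow hab hΦd hΦ' hΦ hp hq]
  have := Gamma_pos_of_pos hp
  have := Gamma_pos_of_pos hq
  have := Gamma_pos_of_pos (add_pos hp hq)
  have := sub_pos.2 hΦ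
  positivity

theorem intervalIntegrable_deriv_mul_sub_rpow {Φ Φ' : ℝ → ℝ} {a b p : ℝ}
    (hab : a ≤ b) (hΦd : ∀ x ∈ Icc a b, HasDerivAt Φ (Φ' x) x)
    (hΦ' : ∀ x ∈ Icc a b, 0 ≤ Φ' x) (hΦ : Φ a < Φ b) (hp : 0 < p) :
    IntervalIntegrable (fun ρ => Φ' ρ * (Φ b - Φ ρ) ^ (p - 1)) volume a b := by
  simpa using intervalIntegrable_deriv_mul_sub_rpow_mul_rpow hab hΦd hΦ' hΦ hp one_pos

theorem mittagLeffler_mono {p q x y : ℝ} (hp : 0 < p) (hq : 0 < q) (hx : 0 ≤ x)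
    (hxy : x ≤ y) : mittagLeffler p q x ≤ mittagLeffler p q y := by
  refine (summable_mittagLeffler hp hq x).tsum_le_tsum (fun k => ?_)
    (summable_mittagLeffler hp hq y)
  have : 0 < Gamma (p * k + q) := Gamma_pos_of_pos (by positivity)
  gcongr

/-- Fractional Grönwall inequality with respect to an increasing function `Φ`. -/
theorem le_mul_mittagLeffler_of_le_add_integral {Φ Φ' w : ℝ → ℝ} {a b μ L δ M : ℝ}
    (hΦd : ∀ x ∈ Icc a b, HasDerivAt Φ (Φ' x) x) (hΦ' : ∀ x ∈ Icc a b, 0 ≤ Φ' x)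
    (hΦ : StrictMonoOn Φ (Icc a b)) (hμ : 0 < μ) (hL : 0 ≤ L)
    (hw : ContinuousOn w (Icc a b)) (hwM : ∀ x ∈ Icc a b, w x ≤ M)
    (hle : ∀ x ∈ Ioc a b,
      w x ≤ δ + L / Gamma μ * ∫ ρ in a..x, Φ' ρ * (Φ x - Φ ρ) ^ (μ - 1) * w ρ) :
    ∀ x ∈ Ioc a b, w x ≤ δ * mittagLeffler μ 1 (L * (Φ x - Φ a) ^ μ) := by
  have hGμ := Gamma_pos_of_pos hμ
  let T : ℕ → ℝ → ℝ := fun k x => (L * (Φ x - Φ a) ^ μ) ^ k / Gamma (μ * k + 1)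
  have hsub : ∀ x ∈ Ioc a b, Icc a x ⊆ Icc a b := fun x hx => Icc_subset_Icc_right hx.2
  have hlt : ∀ x ∈ Ioc a b, Φ a < Φ x := fun x hx =>
    hΦ (left_mem_Icc.2 (hx.1.le.trans hx.2)) (Ioc_subset_Icc_self hx) hx.1
  have hT : ∀ k x, Φ a ≤ Φ x →
      T k x = L ^ k / Gamma (μ * k + 1) * (Φ x - Φ a) ^ (μ * k + 1 - 1) := by
    intro k x hx
    simp only [T]
    rw [add_sub_cancel_right, rpow_mul (sub_nonneg.2 hx), rpow_natCast, mul_pow]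
    ring
  have hKT : ∀ k, ∀ x ∈ Ioc a b, ∀ ρ ∈ uIcc a x, Φ' ρ * (Φ x - Φ ρ) ^ (μ - 1) * T k ρ =
      L ^ k / Gamma (μ * k + 1) *
        (Φ' ρ * (Φ x - Φ ρ) ^ (μ - 1) * (Φ ρ - Φ a) ^ (μ * k + 1 - 1)) := by
    intro k x hx ρ hρ
    rw [uIcc_of_le hx.1.le] at hρ
    rw [hT k ρ (hΦ.monotoneOn (left_mem_Icc.2 (hx.1.le.trans hx.2)) (hsub x hx hρ) hρ.1)]
    ring
  have hint : ∀ k, ∀ x ∈ Ioc a b,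
      IntervalIntegrable (fun ρ => Φ' ρ * (Φ x - Φ ρ) ^ (μ - 1) * T k ρ) volume a x := by
    intro k x hx
    have h := (intervalIntegrable_deriv_mul_sub_rpow_mul_rpow (p := μ) (q := μ * k + 1) hx.1.le
      (fun y hy => hΦd y (hsub x hx hy)) (fun y hy => hΦ' y (hsub x hx hy)) (hlt x hx) hμ
      (by positivity)).const_mul (L ^ k / Gamma (μ * k + 1))
    refine h.congr fun ρ hρ => ?_
    exact (hKT k x hx ρ (uIoc_subset_uIcc hρ)).symm
  have hval : ∀ k, ∀ x ∈ Ioc a b,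
      L / Gamma μ * ∫ ρ in a..x, Φ' ρ * (Φ x - Φ ρ) ^ (μ - 1) * T k ρ = T (k + 1) x := by
    intro k x hx
    have hG : 0 < Gamma (μ * k + 1) := Gamma_pos_of_pos (by positivity)
    rw [intervalIntegral.integral_congr (hKT k x hx), intervalIntegral.integral_const_mul,
      integral_deriv_mul_sub_rpow_mul_rpow hx.1.le
        (fun y hy => hΦd y (hsub x hx hy)) (fun y hy => hΦ' y (hsub x hx hy)) (hlt x hx) hμ
        (by positivity), hT _ _ (hlt x hx).le]
    push_cast
    rw [show μ + (μ * k + 1) = μ * (k + 1) + 1 by ring]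
    field_simp
    ring
  have hind : ∀ n : ℕ, ∀ x ∈ Ioc a b, w x ≤ δ * ∑ k ∈ Finset.range n, T k x + M * T n x := by
    intro n
    induction n with
    | zero =>
      intro x hx
      simpa [T] using hwM x (Ioc_subset_Icc_self hx)
    | succ n ih =>
      intro x hx
      have hsumint : IntervalIntegrable
          (fun ρ => ∑ k ∈ Finset.range n, Φ' ρ * (Φ x - Φ ρ) ^ (μ - 1) * T k ρ) volume a x :=
        by
        have h := IntervalIntegrable.sum (Finset.range n) fun k _ => hint k x hx
        rwa [Finset.sum_fn] at h
      have hmono : ∫ ρ in a..x, Φ' ρ * (Φ x - Φ ρ) ^ (μ - 1) * w ρ ≤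
          ∫ ρ in a..x, (δ * ∑ k ∈ Finset.range n, Φ' ρ * (Φ x - Φ ρ) ^ (μ - 1) * T k ρ +
            M * (Φ' ρ * (Φ x - Φ ρ) ^ (μ - 1) * T n ρ)) := by
        refine intervalIntegral.integral_mono_on_of_le_Ioo hx.1.le ?_
          ((hsumint.const_mul _).add ((hint n x hx).const_mul _)) fun ρ hρ => ?_
        · refine (intervalIntegrable_deriv_mul_sub_rpow hx.1.le
            (fun y hy => hΦd y (hsub x hx hy)) (fun y hy => hΦ' y (hsub x hx hy))
            (hlt x hx) hμ).mul_continuousOn ?_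
          rw [uIcc_of_le hx.1.le]
          exact hw.mono (hsub x hx)
        · have hρb : ρ ∈ Ioc a b := ⟨hρ.1, hρ.2.le.trans hx.2⟩
          have hK : 0 ≤ Φ' ρ * (Φ x - Φ ρ) ^ (μ - 1) :=
            mul_nonneg (hΦ' ρ (Ioc_subset_Icc_self hρb)) (rpow_nonneg (sub_nonneg.2
              (hΦ.monotoneOn (Ioc_subset_Icc_self hρb) (Ioc_subset_Icc_self hx) hρ.2.le)) _)
          refine (mul_le_mul_of_nonneg_left (ih ρ hρb) hK).trans_eq ?_
          rw [← Finset.mul_sum]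
          ring
      rw [intervalIntegral.integral_add (hsumint.const_mul _) ((hint n x hx).const_mul _),
        intervalIntegral.integral_const_mul, intervalIntegral.integral_const_mul,
        intervalIntegral.integral_finsetSum fun k _ => hint k x hx] at hmono
      have hT0 : T 0 x = 1 := by simp [T]
      have hmono' := mul_le_mul_of_nonneg_left hmono (div_nonneg hL hGμ.le)
      refine (hle x hx).trans ((add_le_add le_rfl hmono').trans_eq ?_)
      rw [Finset.sum_range_succ', hT0, ← hval n x hx,
        ← Finset.sum_congr rfl fun k _ => hval k x hx, ← Finset.mul_sum]
      ring
  intro x hx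
  have hs := summable_mittagLeffler hμ one_pos (L * (Φ x - Φ a) ^ μ)
  have hlim := (hs.hasSum.tendsto_sum_nat.const_mul δ).add (hs.tendsto_atTop_zero.const_mul M)
  rw [mul_zero, add_zero] at hlim
  exact ge_of_tendsto' hlim fun n => hind n x hx

/-- Continuous dependence on initial data: if `z` and `z̄` solve the
integral equation with initial values `z_a`, `z̄_a` respectively, then
`sup_{ℓ∈[a,b]} |z(ℓ) − z̄(ℓ)| ≤ E_μ(L(Φ(b)−Φ(a))^μ) |z_a − z̄_a|`. -/
theorem continuous_dependence
    (a b : ℝ) (hab : a < b)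
    (Φ Φ' : ℝ → ℝ)
    (hΦd : ∀ x ∈ Icc a b, HasDerivAt Φ (Φ' x) x)
    (hΦ'c : ContinuousOn Φ' (Icc a b))
    (hΦ'pos : ∀ x ∈ Icc a b, 0 < Φ' x)
    (μ κ ω za zba : ℝ) (hκ0 : 0 < κ) (hκμ : κ < μ) (hμ1 : μ < 1) (hω : 0 < ω)
    (F : ℝ → ℝ → ℝ)
    (hFc : ContinuousOn (fun p : ℝ × ℝ => F p.1 p.2) (Icc a b ×ˢ (univ : Set ℝ)))
    (L : ℝ) (hL : 0 < L)
    (hlip : ∀ ℓ ∈ Icc a b, ∀ x y : ℝ, |F ℓ y - F ℓ x| ≤ L * |y - x|)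
    (z zb : ℝ → ℝ) (hzc : ContinuousOn z (Icc a b)) (hzbc : ContinuousOn zb (Icc a b))
    (hz : ∀ ℓ ∈ Icc a b,
      z ℓ = za + ∫ ρ in a..ℓ,
        Φ' ρ * (Φ ℓ - Φ ρ) ^ (μ - 1) *
          mittagLeffler (μ - κ) μ (-ω * (Φ ℓ - Φ ρ) ^ (μ - κ)) * F ρ (z ρ))
    (hzb : ∀ ℓ ∈ Icc a b,
      zb ℓ = zba + ∫ ρ in a..ℓ,
        Φ' ρ * (Φ ℓ - Φ ρ) ^ (μ - 1) *
          mittagLeffler (μ - κ) μ (-ω * (Φ ℓ - Φ ρ) ^ (μ - κ)) * F ρ (zb ρ)) :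
    (⨆ ℓ : Icc a b, |z (ℓ : ℝ) - zb (ℓ : ℝ)|) ≤
      mittagLeffler μ 1 (L * (Φ b - Φ a) ^ μ) * |za - zba| := by
  have hμ : 0 < μ := hκ0.trans hκμ
  have hα : 0 < μ - κ := sub_pos.2 hκμ
  have hGμ := Gamma_pos_of_pos hμ
  have hΦ'nonneg : ∀ x ∈ Icc a b, 0 ≤ Φ' x := fun x hx => (hΦ'pos x hx).le
  have hΦc : ContinuousOn Φ (Icc a b) := fun x hx =>
    (hΦd x hx).continuousAt.continuousWithinAt
  have hΦmono : StrictMonoOn Φ (Icc a b) := by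
    refine strictMonoOn_of_deriv_pos (convex_Icc a b) hΦc fun x hx => ?_
    rw [(hΦd x (interior_subset hx)).deriv]
    exact hΦ'pos x (interior_subset hx)
  have hwc : ContinuousOn (fun x => |z x - zb x|) (Icc a b) := (hzc.sub hzbc).abs
  obtain ⟨M, hM⟩ := isCompact_Icc.bddAbove_image hwc
  have hle : ∀ x ∈ Ioc a b, |z x - zb x| ≤ |za - zba| + L / Gamma μ *
      ∫ ρ in a..x, Φ' ρ * (Φ x - Φ ρ) ^ (μ - 1) * |z ρ - zb ρ| := by
    intro x hx
    have hxI : x ∈ Icc a b := Ioc_subset_Icc_self hx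
    have hsub : Icc a x ⊆ Icc a b := Icc_subset_Icc_right hx.2
    have hK : IntervalIntegrable (fun ρ => Φ' ρ * (Φ x - Φ ρ) ^ (μ - 1)) volume a x :=
      intervalIntegrable_deriv_mul_sub_rpow hx.1.le (fun y hy => hΦd y (hsub hy))
        (fun y hy => hΦ'nonneg y (hsub hy))
        (hΦmono (left_mem_Icc.2 hab.le) hxI hx.1) hμ
    have hE : ContinuousOn
        (fun ρ => mittagLeffler (μ - κ) μ (-ω * (Φ x - Φ ρ) ^ (μ - κ))) (uIcc a x) := by
      rw [uIcc_of_le hx.1.le]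
      refine (continuous_mittagLeffler hα hμ).comp_continuousOn (continuousOn_const.mul ?_)
      exact (continuousOn_const.sub (hΦc.mono hsub)).rpow_const fun _ _ => Or.inr hα.le
    have hint : ∀ y : ℝ → ℝ, ContinuousOn y (Icc a b) → IntervalIntegrable (fun ρ =>
        Φ' ρ * (Φ x - Φ ρ) ^ (μ - 1) *
          mittagLeffler (μ - κ) μ (-ω * (Φ x - Φ ρ) ^ (μ - κ)) * F ρ (y ρ)) volume a x := by
      intro y hy
      refine (hK.mul_continuousOn hE).mul_continuousOn ?_
      rw [uIcc_of_le hx.1.le]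
      exact hFc.comp (continuousOn_id.prodMk (hy.mono hsub)) fun ρ hρ => ⟨hsub hρ, mem_univ _⟩
    have hbound := intervalIntegral.norm_integral_le_of_norm_le (μ := volume) hx.1.le
      (f := fun ρ => Φ' ρ * (Φ x - Φ ρ) ^ (μ - 1) *
          mittagLeffler (μ - κ) μ (-ω * (Φ x - Φ ρ) ^ (μ - κ)) * F ρ (z ρ) -
        Φ' ρ * (Φ x - Φ ρ) ^ (μ - 1) *
          mittagLeffler (μ - κ) μ (-ω * (Φ x - Φ ρ) ^ (μ - κ)) * F ρ (zb ρ))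
      (g := fun ρ => L / Gamma μ * (Φ' ρ * (Φ x - Φ ρ) ^ (μ - 1) * |z ρ - zb ρ|))
      (Filter.Eventually.of_forall fun ρ hρ => ?_) ((hK.mul_continuousOn ?_).const_mul _)
    · rw [intervalIntegral.integral_sub (hint z hzc) (hint zb hzbc),
        intervalIntegral.integral_const_mul] at hbound
      have hdiff : z x - zb x = (za - zba) + ((∫ ρ in a..x, Φ' ρ * (Φ x - Φ ρ) ^ (μ - 1) *
          mittagLeffler (μ - κ) μ (-ω * (Φ x - Φ ρ) ^ (μ - κ)) * F ρ (z ρ)) -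
          ∫ ρ in a..x, Φ' ρ * (Φ x - Φ ρ) ^ (μ - 1) *
          mittagLeffler (μ - κ) μ (-ω * (Φ x - Φ ρ) ^ (μ - κ)) * F ρ (zb ρ)) := by
        rw [hz x hxI, hzb x hxI]
        ring
      rw [hdiff]
      exact (abs_add_le _ _).trans (by gcongr; exact hbound)
    · have hρI : ρ ∈ Icc a b := hsub (Ioc_subset_Icc_self hρ)
      have hX : 0 ≤ Φ x - Φ ρ := sub_nonneg.2 (hΦmono.monotoneOn hρI hxI hρ.2)
      have hK0 : 0 ≤ Φ' ρ * (Φ x - Φ ρ) ^ (μ - 1) :=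
        mul_nonneg (hΦ'nonneg ρ hρI) (rpow_nonneg hX _)
      have hE0 := abs_mittagLeffler_neg_le (β := μ) hα (by linarith) (by linarith)
        (mul_nonneg hω.le (rpow_nonneg hX (μ - κ)))
      rw [← neg_mul] at hE0
      rw [← mul_sub, norm_mul, norm_mul, norm_eq_abs, norm_eq_abs, norm_eq_abs, abs_of_nonneg hK0]
      calc _ ≤ Φ' ρ * (Φ x - Φ ρ) ^ (μ - 1) * (Gamma μ)⁻¹ * (L * |z ρ - zb ρ|) := by
            gcongr
            exact hlip ρ hρI _ _
        _ = _ := by ring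
    · rw [uIcc_of_le hx.1.le]
      exact hwc.mono hsub
  have hgron := le_mul_mittagLeffler_of_le_add_integral hΦd hΦ'nonneg hΦmono hμ hL.le hwc
    (fun x hx => hM (mem_image_of_mem _ hx)) hle
  have : Nonempty (Icc a b) := ⟨⟨a, left_mem_Icc.2 hab.le⟩⟩
  refine ciSup_le fun ⟨x, hx⟩ => ?_
  rw [mul_comm]
  rcases hx.1.eq_or_lt with rfl | hax
  · have h1 : mittagLeffler μ 1 0 ≤ mittagLeffler μ 1 (L * (Φ b - Φ a) ^ μ) := by
      refine mittagLeffler_mono hμ one_pos le_rfl (mul_nonneg hL.le (rpow_nonneg ?_ _))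
      exact sub_nonneg.2 (hΦmono.monotoneOn hx (right_mem_Icc.2 hab.le) hab.le)
    rw [mittagLeffler_zero, Gamma_one, inv_one] at h1
    have h2 : z a - zb a = za - zba := by
      rw [hz a hx, hzb a hx]
      simp
    simp only [h2]
    exact le_mul_of_one_le_right (abs_nonneg _) h1
  · refine (hgron x ⟨hax, hx.2⟩).trans ?_
    have h1 : Φ a ≤ Φ x := hΦmono.monotoneOn (left_mem_Icc.2 hab.le) hx hx.1
    have h2 : Φ x ≤ Φ b := hΦmono.monotoneOn hx (right_mem_Icc.2 hab.le) hx.2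
    have h3 : 0 ≤ Φ x - Φ a := sub_nonneg.2 h1
    refine mul_le_mul_of_nonneg_left (mittagLeffler_mono hμ one_pos (by positivity) ?_)
      (abs_nonneg _)
    gcongr
end
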